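/- Let d ∈ ℕ, let K ⊂ ℝ^d be compact, let f : K → ℝ be continuous, and let ρ : ℝ → ℝ be continuous and not equal to any polynomial. Then for every ε > 0 there exist N ∈ ℕ and a_k, b_k ∈ ℝ and w_k ∈ ℝ^d for 1 ≤ k ≤ N such that sup_{x ∈ K} | f(x) − Σ_{k=1}^N a_k ρ(⟨w_k, x⟩ − b_k) | ≤ ε. (Universal approximation theorem for shallow networks.) -/

import Mathlib

open Filter Topology MeasureTheory

/-- A smooth function with vanishing `k`-th derivative is a polynomial of degree `< k`. -/
lemma ua_poly_of_iteratedDeriv_zero (k : ℕ) : ∀ f : ℝ → ℝ, ContDiff ℝ (⊤ : ℕ∞) f →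
    (∀ x, iteratedDeriv k f x = 0) →
    ∃ p : Polynomial ℝ, p.degree < k ∧ ∀ x, f x = p.eval x := by
  induction k with
  | zero =>
    intro f _ h
    exact ⟨0, by simp, fun x => by simpa using h x⟩
  | succ k ih =>
    intro f hf h
    have hd : ContDiff ℝ (⊤ : ℕ∞) (deriv f) := by
      have h2 := (contDiff_succ_iff_deriv (n := ((⊤ : ℕ∞) : WithTop ℕ∞)) (f := f)).1 (by simpa using hf)
      exact h2.2.2
    obtain ⟨p, hp, hpe⟩ := ih (deriv f) hd (fun x => by
      rw [← iteratedDeriv_succ']; exact h x)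
    let P : Polynomial ℝ := ∑ i ∈ Finset.range k,
      Polynomial.C (p.coeff i / (i + 1)) * Polynomial.X ^ (i + 1)
    have hPd : P.derivative = p := by
      have hp2 : p = ∑ i ∈ Finset.range k, Polynomial.C (p.coeff i) * Polynomial.X ^ i := by
        ext n
        simp only [Polynomial.finsetSum_coeff, Polynomial.coeff_C_mul_X_pow]
        rw [Finset.sum_ite_eq]
        split_ifs with hn
        · rfl
        · apply Polynomial.coeff_eq_zero_of_degree_lt
          refine lt_of_lt_of_le hp ?_
          simp at hn
          exact_mod_cast hn
      conv_rhs => rw [hp2]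
      simp only [P, Polynomial.derivative_sum]
      refine Finset.sum_congr rfl fun i _ => ?_
      rw [Polynomial.derivative_C_mul_X_pow]
      congr 2
      push_cast
      field_simp
    have hPdeg : P.degree < (k + 1 : ℕ) := by
      rw [Polynomial.degree_lt_iff_coeff_zero]
      intro m hm
      simp only [P, Polynomial.finsetSum_coeff, Polynomial.coeff_C_mul_X_pow]
      refine Finset.sum_eq_zero fun i hi => ?_
      rw [if_neg]
      simp at hi
      omega
    have hdiff : Differentiable ℝ f := hf.differentiable (by simp)
    have hconst : ∀ x, f x - P.eval x = f 0 - P.eval 0 := by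
      intro x
      refine is_const_of_deriv_eq_zero (f := fun x => f x - P.eval x)
        (hdiff.sub P.differentiable) (fun x => ?_) x 0
      rw [deriv_fun_sub (hdiff x) P.differentiableAt, Polynomial.deriv, hPd, hpe]
      simp
    refine ⟨P + Polynomial.C (f 0 - P.eval 0), ?_, fun x => ?_⟩
    · refine lt_of_le_of_lt (Polynomial.degree_add_le _ _) (max_lt hPdeg ?_)
      refine lt_of_le_of_lt Polynomial.degree_C_le ?_
      exact_mod_cast Nat.succ_pos k
    · rw [Polynomial.eval_add, Polynomial.eval_C, ← hconst x]; ring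

/-- A pointwise limit of polynomials of degree `< k` is a polynomial. -/
lemma ua_poly_limit (k : ℕ) (F : ℕ → ℝ → ℝ) (ρ : ℝ → ℝ)
    (hF : ∀ n, ∃ p : Polynomial ℝ, p.degree < k ∧ ∀ x, F n x = p.eval x)
    (hlim : ∀ x, Tendsto (fun n => F n x) atTop (𝓝 (ρ x))) :
    ∃ p : Polynomial ℝ, ∀ x, ρ x = p.eval x := by
  have hinj : Set.InjOn (fun i : ℕ => (i : ℝ)) (Finset.range k) :=
    fun a _ b _ h => by simpa using h
  refine ⟨Lagrange.interpolate (Finset.range k) (fun i : ℕ => (i : ℝ)) (fun i => ρ i),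
    fun x => ?_⟩
  refine tendsto_nhds_unique (hlim x) ?_
  have h1 : ∀ n, F n x = ∑ i ∈ Finset.range k,
      F n i * (Lagrange.basis (Finset.range k) (fun i : ℕ => (i : ℝ)) i).eval x := by
    intro n
    obtain ⟨p, hp, hpe⟩ := hF n
    have := Lagrange.eq_interpolate (f := p) hinj (by simpa using hp)
    rw [hpe x]
    conv_lhs => rw [this]
    simp [Lagrange.interpolate_apply, Polynomial.eval_finsetSum, hpe]
  simp_rw [h1]
  simp only [Lagrange.interpolate_apply, Polynomial.eval_finsetSum, Polynomial.eval_mul,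
    Polynomial.eval_C]
  exact tendsto_finsetSum _ fun i _ => (hlim i).mul_const _

section
variable {X : Type*} [TopologicalSpace X] [CompactSpace X]

/-- The function `x ↦ u x ^ k * g (s * u x + b)`. -/
noncomputable def uaRidge (u : C(X, ℝ)) (k : ℕ) (g : ℝ → ℝ) (hg : Continuous g) (s b : ℝ) :
    C(X, ℝ) :=
  ⟨fun x => u x ^ k * g (s * u x + b), by fun_prop⟩

lemma ua_integral_mem {E : Type*} [NormedAddCommGroup E] [NormedSpace ℝ E] [CompleteSpace E]
    (S : Submodule ℝ E) (hS : IsClosed (S : Set E)) (G : ℝ → E) (hG : ∀ t, G t ∈ S) :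
    ∫ t, G t ∈ S := by
  have : CompleteSpace S := hS.completeSpace_coe
  have := LinearIsometry.integral_comp_comm (𝕜 := ℝ) S.subtypeₗᵢ (μ := volume) (fun t => (⟨G t, hG t⟩ : S))
  simp only [Submodule.coe_subtypeₗᵢ, Submodule.subtype_apply] at this
  rw [this]
  exact Submodule.coe_mem _

lemma ua_deriv_mem (S : Submodule ℝ C(X, ℝ)) (hS : IsClosed (S : Set C(X, ℝ)))
    (G : ℝ → C(X, ℝ)) (hG : ∀ t, G t ∈ S) (s : ℝ) (G' : C(X, ℝ)) (h : HasDerivAt G G' s) :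
    G' ∈ S := by
  rw [hasDerivAt_iff_tendsto_slope] at h
  refine hS.mem_of_tendsto h (Eventually.of_forall fun t => ?_)
  exact S.smul_mem _ (S.sub_mem (hG _) (hG _))

lemma ua_ridge_hasDerivAt (u : C(X, ℝ)) (k : ℕ) (g g' : ℝ → ℝ) (hg : Continuous g)
    (hg' : Continuous g') (h : ∀ x, HasDerivAt g (g' x) x) (s b : ℝ) :
    HasDerivAt (fun s => uaRidge u k g hg s b) (uaRidge u (k + 1) g' hg' s b) s := by
  have hc : Continuous (fun s => uaRidge u (k + 1) g' hg' s b) := by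
    refine ContinuousMap.continuous_of_continuous_uncurry _ ?_
    simp only [uaRidge, Function.uncurry_def, ContinuousMap.coe_mk]
    fun_prop
  have key : (fun s => uaRidge u k g hg s b) = fun s =>
      (∫ t in (0:ℝ)..s, uaRidge u (k + 1) g' hg' t b) + uaRidge u k g hg 0 b := by
    funext s
    ext x
    have h1 := (ContinuousMap.evalCLM ℝ (M := ℝ) x).intervalIntegral_comp_comm
      (hc.intervalIntegrable (μ := volume) 0 s)
    simp only [ContinuousMap.evalCLM_apply] at h1
    rw [ContinuousMap.add_apply, ← h1]
    have h2 := intervalIntegral.integral_eq_sub_of_hasDerivAt (a := 0) (b := s)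
      (f := fun t => uaRidge u k g hg t b x) (f' := fun t => uaRidge u (k + 1) g' hg' t b x)
      (fun t _ => by
        simp only [uaRidge, ContinuousMap.coe_mk]
        have h3 : HasDerivAt (fun t : ℝ => t * u x + b) (u x) t := by
          simpa using ((hasDerivAt_id t).mul_const (u x)).add_const b
        have h4 := ((h (t * u x + b)).comp t h3).const_mul (u x ^ k)
        refine h4.congr_deriv ?_
        ring)
      (Continuous.intervalIntegrable (by
        simp only [uaRidge, ContinuousMap.coe_mk]; fun_prop) _ _)
    rw [h2]; ring
  rw [key]
  exact (intervalIntegral.integral_hasDerivAt_right (hc.intervalIntegrable _ _)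
    hc.aestronglyMeasurable.stronglyMeasurableAtFilter hc.continuousAt).add_const _

lemma ua_iter_mem (S : Submodule ℝ C(X, ℝ)) (hS : IsClosed (S : Set C(X, ℝ))) (u : C(X, ℝ))
    (f : ℝ → ℝ) (hf : ContDiff ℝ (⊤ : ℕ∞) f)
    (h0 : ∀ s b, uaRidge u 0 f hf.continuous s b ∈ S) (k : ℕ) :
    ∀ (hc : Continuous (iteratedDeriv k f)) (s b : ℝ), uaRidge u k (iteratedDeriv k f) hc s b ∈ S := by
  induction k with
  | zero =>
    intro hc s b
    convert h0 s b using 2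
    exact iteratedDeriv_zero
  | succ k ih =>
    intro hc s b
    have hck : Continuous (iteratedDeriv k f) := hf.continuous_iteratedDeriv k (by exact_mod_cast le_top)
    refine ua_deriv_mem S hS _ (fun t => ih hck t b) s _
      (ua_ridge_hasDerivAt u k _ _ hck hc (fun x => ?_) s b)
    rw [iteratedDeriv_succ]
    exact (hf.differentiable_iteratedDeriv k (by exact_mod_cast ENat.natCast_lt_top k) x).hasDerivAt

lemma ua_pow_mem (S : Submodule ℝ C(X, ℝ)) (hS : IsClosed (S : Set C(X, ℝ))) (u : C(X, ℝ))
    (ρ : ℝ → ℝ) (hρ : Continuous ρ)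
    (hpoly : ¬ ∃ p : Polynomial ℝ, ∀ x : ℝ, ρ x = p.eval x)
    (h0 : ∀ s b, uaRidge u 0 ρ hρ s b ∈ S) (k : ℕ) : u ^ k ∈ S := by
  by_contra hk
  apply hpoly
  let φ : ℕ → ContDiffBump (0 : ℝ) := fun n =>
    ⟨1 / (n + 1) / 2, 1 / (n + 1), by positivity, by
      have : (0:ℝ) < 1 / (n + 1) := by positivity
      linarith⟩
  let F : ℕ → ℝ → ℝ := fun n =>
    convolution ((φ n).normed volume) ρ (ContinuousLinearMap.lsmul ℝ ℝ) volume
  refine ua_poly_limit k F ρ (fun n => ?_) (fun x => ?_)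
  · have hF : ContDiff ℝ (⊤ : ℕ∞) (F n) :=
      (φ n).hasCompactSupport_normed.contDiff_convolution_left _ (φ n).contDiff_normed
        hρ.locallyIntegrable
    refine ua_poly_of_iteratedDeriv_zero k _ hF (fun y => ?_)
    by_contra hy
    apply hk
    have hmem : ∀ s b, uaRidge u 0 (F n) hF.continuous s b ∈ S := by
      intro s b
      let G : ℝ → C(X, ℝ) := fun t => (φ n).normed volume t • uaRidge u 0 ρ hρ s (b - t)
      have hG : Continuous G := by
        refine Continuous.smul (φ n).continuous_normed ?_
        refine ContinuousMap.continuous_of_continuous_uncurry _ ?_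
        simp only [uaRidge, Function.uncurry_def, ContinuousMap.coe_mk]
        fun_prop
      have hGi : Integrable G :=
        hG.integrable_of_hasCompactSupport (φ n).hasCompactSupport_normed.smul_right
      have h1 := ua_integral_mem S hS G (fun t => S.smul_mem _ (h0 _ _))
      convert h1 using 1
      ext x
      have h2 := (ContinuousMap.evalCLM ℝ (M := ℝ) x).integral_comp_comm hGi
      simp only [ContinuousMap.evalCLM_apply] at h2
      rw [← h2]
      simp [uaRidge, F, G, convolution_def, add_sub_assoc]
    have hc : Continuous (iteratedDeriv k (F n)) :=
      hF.continuous_iteratedDeriv k (by exact_mod_cast le_top)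
    have h3 := ua_iter_mem S hS u (F n) hF hmem k hc 0 y
    have h4 := S.smul_mem (iteratedDeriv k (F n) y)⁻¹ h3
    convert h4 using 1
    ext x
    simp [uaRidge]
    field_simp
  · refine ContDiffBump.convolution_tendsto_right_of_continuous ?_ hρ x
    exact tendsto_one_div_add_atTop_nhds_zero_nat

lemma ua_exp_mem (S : Submodule ℝ C(X, ℝ)) (hS : IsClosed (S : Set C(X, ℝ))) (u : C(X, ℝ))
    (h : ∀ k, u ^ k ∈ S) : NormedSpace.exp u ∈ S := by
  refine hS.mem_of_tendsto (NormedSpace.exp_series_hasSum_exp' (𝕂 := ℝ) u)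
    (Eventually.of_forall fun s => ?_)
  exact S.sum_mem fun i _ => S.smul_mem _ (h i)

lemma ua_exp_apply (u : C(X, ℝ)) (x : X) : NormedSpace.exp u x = Real.exp (u x) := by
  have := NormedSpace.map_exp (ContinuousMap.evalAlgHom ℝ ℝ x)
    (continuous_eval_const x : Continuous fun g : C(X, ℝ) => g x) u
  simpa [Real.exp_eq_exp_ℝ] using this
end

/-- **Universal approximation theorem.**
Let `K ⊆ ℝ^d` be compact, `f : K → ℝ` continuous, and let `ρ : ℝ → ℝ` be continuous
and not a polynomial. Then for every `ε > 0` there is a shallow neural network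
`x ↦ ∑ k, a k * ρ (⟨w k, x⟩ - b k)` approximating `f` uniformly on `K` up to `ε`. -/
theorem universal_approximation
    (d : ℕ) (K : Set (Fin d → ℝ)) (hK : IsCompact K)
    (f : (Fin d → ℝ) → ℝ) (hf : ContinuousOn f K)
    (ρ : ℝ → ℝ) (hρ : Continuous ρ)
    (hpoly : ¬ ∃ p : Polynomial ℝ, ∀ x : ℝ, ρ x = p.eval x) :
    ∀ ε : ℝ, 0 < ε →
      ∃ (N : ℕ) (a b : Fin N → ℝ) (w : Fin N → (Fin d → ℝ)),
        ∀ x ∈ K, |f x - ∑ k, a k * ρ ((∑ i, w k i * x i) - b k)| ≤ ε := by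
  intro ε hε
  have : CompactSpace K := isCompact_iff_compactSpace.mp hK
  have hsum : ∀ w : Fin d → ℝ, Continuous fun x : K => ∑ i, w i * x.1 i := fun w =>
    continuous_finsetSum _ fun i _ =>
      continuous_const.mul ((continuous_apply i).comp continuous_subtype_val)
  let u : (Fin d → ℝ) → C(K, ℝ) := fun w => ⟨fun x => ∑ i, w i * x.1 i, hsum w⟩
  let nrn : (Fin d → ℝ) × ℝ → C(K, ℝ) := fun q =>
    ⟨fun x => ρ ((∑ i, q.1 i * x.1 i) - q.2),
      hρ.comp ((hsum q.1).sub continuous_const)⟩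
  let S : Submodule ℝ C(K, ℝ) := (Submodule.span ℝ (Set.range nrn)).topologicalClosure
  have hS : IsClosed (S : Set C(K, ℝ)) := Submodule.isClosed_topologicalClosure _
  have hexp : ∀ w, NormedSpace.exp (u w) ∈ S := by
    intro w
    refine ua_exp_mem S hS _ (fun k => ua_pow_mem S hS (u w) ρ hρ hpoly (fun s b => ?_) k)
    apply Submodule.le_topologicalClosure
    apply Submodule.subset_span
    refine ⟨(s • w, -b), ?_⟩
    ext x
    simp [nrn, uaRidge, u, Finset.mul_sum, mul_assoc]
  let M : Submonoid C(K, ℝ) :=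
    { carrier := Set.range fun w => NormedSpace.exp (u w)
      one_mem' := ⟨0, by ext x; simp [ua_exp_apply, u]⟩
      mul_mem' := by
        rintro _ _ ⟨w, rfl⟩ ⟨v, rfl⟩
        refine ⟨w + v, ?_⟩
        ext x
        simp [ua_exp_apply, u, add_mul, Finset.sum_add_distrib, Real.exp_add] }
  have hA : Subalgebra.toSubmodule (Algebra.adjoin ℝ (M : Set C(K, ℝ))) ≤ S := by
    rw [Algebra.adjoin_eq_span, Submonoid.closure_eq, Submodule.span_le]
    rintro _ ⟨w, rfl⟩
    exact hexp w
  have hsep : (Algebra.adjoin ℝ (M : Set C(K, ℝ))).SeparatesPoints := by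
    intro x y hxy
    have : ∃ i, x.1 i ≠ y.1 i := by
      by_contra! h
      exact hxy (Subtype.ext (funext h))
    obtain ⟨i, hi⟩ := this
    refine ⟨_, ⟨NormedSpace.exp (u (Pi.single i 1)), Algebra.subset_adjoin ⟨_, rfl⟩, rfl⟩, ?_⟩
    simpa [ua_exp_apply, u, Pi.single_apply] using hi
  have htop := ContinuousMap.subalgebra_topologicalClosure_eq_top_of_separatesPoints _ hsep
  let f' : C(K, ℝ) := ⟨fun x => f x.1, hf.domRestrict⟩
  have hf' : f' ∈ S := by
    have h1 : f' ∈ (Algebra.adjoin ℝ (M : Set C(K, ℝ))).topologicalClosure := by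
      rw [htop]; trivial
    exact closure_minimal (fun g hg => hA hg) hS h1
  obtain ⟨g, hg, hgd⟩ := Metric.mem_closure_iff.1 hf' ε hε
  obtain ⟨N, a, q, hq⟩ := Submodule.mem_span_set'.1 hg
  choose q' hq' using fun i => (q i).2
  refine ⟨N, a, fun k => (q' k).2, fun k => (q' k).1, fun x hx => ?_⟩
  have h2 := (ContinuousMap.dist_apply_le_dist (f := f') (g := g) ⟨x, hx⟩).trans hgd.le
  rw [Real.dist_eq, ← hq] at h2
  simp only [← hq'] at h2
  have h3 : f' ⟨x, hx⟩ = f x := rfl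
  rw [h3] at h2
  simpa [nrn] using h2
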